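/- arXiv:2603.29519 — 3 statements merged into one kernel-verified Lean document; each statement's English description precedes it below -/
import Mathlib

section
/- Let q, n ≥ 1 and k ≥ 0 be integers, and let S ∈ {−1,+1}^{q×n} be a sign matrix such that every row of S contains at most k entries equal to +1. Then there exists a real matrix M ∈ ℝ^{q×n} with rank(M) ≤ 2k + 1 such that for all i, j: M_{ij} > 0 if S_{ij} = +1 and M_{ij} < 0 if S_{ij} = −1. In particular, the sign rank of S is at most 2k + 1. -/
open Polynomial in
/-- Evaluations of polynomials of degree less than `d` form a matrix of rank at most `d`. -/
theorem rank_eval_le_of_natDegree_lt {m n : Type*} [Fintype m] [Fintype n] (d : ℕ)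
    (p : m → ℝ[X]) (x : n → ℝ) (hp : ∀ i, (p i).natDegree < d) :
    (Matrix.of fun i j => (p i).eval (x j)).rank ≤ d := by
  have h : (Matrix.of fun i j => (p i).eval (x j)) =
      (Matrix.of fun i (e : Fin d) => (p i).coeff e) *
        Matrix.of fun (e : Fin d) j => x j ^ (e : ℕ) := by
    ext i j
    simp only [Matrix.of_apply, Matrix.mul_apply]
    rw [eval_eq_sum_range' (hp i), ← Fin.sum_univ_eq_sum_range
      (fun e => (p i).coeff e * x j ^ e)]
  rw [h]
  exact (Matrix.rank_mul_le_left _ _).trans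
    ((Matrix.rank_le_card_width _).trans_eq (Fintype.card_fin d))

/-- The square of the difference of two distinct natural numbers is at least one. -/
theorem one_le_sq_natCast_sub {a b : ℕ} (h : a ≠ b) : (1 : ℝ) ≤ ((a : ℝ) - b) ^ 2 := by
  have h0 : (a : ℤ) - b ≠ 0 := sub_ne_zero.mpr (Nat.cast_injective.ne h)
  have h1 : (1 : ℤ) ≤ ((a : ℤ) - b) ^ 2 := Int.add_one_le_of_lt (sq_pos_of_ne_zero h0)
  exact_mod_cast h1

/-- A sign matrix `S ∈ {−1,+1}^{q×n}` with at most `k` entries `+1` per row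
has sign rank at most `2k + 1`: there is a real matrix `M` of rank ≤ `2k+1` whose
entrywise signs agree with `S`. -/
theorem signRank_le_of_row_sparse (q n k : ℕ) (hq : 1 ≤ q) (hn : 1 ≤ n)
    (S : Matrix (Fin q) (Fin n) ℤ)
    (hS : ∀ i j, S i j = 1 ∨ S i j = -1)
    (hrow : ∀ i, (Finset.univ.filter (fun j => S i j = 1)).card ≤ k) :
    ∃ M : Matrix (Fin q) (Fin n) ℝ, M.rank ≤ 2 * k + 1 ∧
      ∀ i j, (S i j = 1 → 0 < M i j) ∧ (S i j = -1 → M i j < 0) := by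
  let P : Fin q → Polynomial ℝ := fun i => Polynomial.C (1 / 2) -
    ∏ t ∈ Finset.univ.filter (fun j => S i j = 1),
      (Polynomial.X - Polynomial.C ((t : ℕ) : ℝ)) ^ 2
  have hP (i : Fin q) (y : ℝ) : (P i).eval y =
      1 / 2 - ∏ t ∈ Finset.univ.filter (fun j => S i j = 1), (y - ((t : ℕ) : ℝ)) ^ 2 := by
    simp [P, Polynomial.eval_prod]
  refine ⟨Matrix.of fun i j => (P i).eval ((j : ℕ) : ℝ),
    rank_eval_le_of_natDegree_lt _ P _ fun i => Nat.lt_succ_of_le ?_,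
    fun i j => ⟨fun h => ?_, fun h => ?_⟩⟩
  · refine (Polynomial.natDegree_sub_le _ _).trans (max_le (by simp) ?_)
    refine (Polynomial.natDegree_prod_le _ _).trans ?_
    simp only [Polynomial.natDegree_pow, Polynomial.natDegree_X_sub_C, Finset.sum_const,
      smul_eq_mul]
    have := hrow i
    omega
  · rw [Matrix.of_apply, hP, Finset.prod_eq_zero (i := j) (by simpa using h) (by simp)]
    norm_num
  · rw [Matrix.of_apply, hP]
    have : (1 : ℝ) ≤ ∏ t ∈ Finset.univ.filter (fun j => S i j = 1),
        (((j : ℕ) : ℝ) - ((t : ℕ) : ℝ)) ^ 2 := by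
      refine Finset.prod_induction _ (fun r : ℝ => 1 ≤ r) (fun _ _ => one_le_mul_of_one_le_of_one_le)
        le_rfl fun t ht => one_le_sq_natCast_sub fun hjt => ?_
      rw [Finset.mem_filter, ← Fin.ext hjt, h] at ht
      exact absurd ht.2 (by decide)
    linarith
end

section
/- Let q, n ≥ 1 and k ≥ 0 be integers, and let R ∈ {0,1}^{q×n} be a binary relevance matrix such that every row of R contains at most k ones. Then there exist vectors u_1,…,u_q and v_1,…,v_n in ℝ^{2k+1} such that for all i ∈ {1,…,q} and j ∈ {1,…,n}: the inner product ⟨u_i, v_j⟩ is strictly positive if R_{ij} = 1 and strictly negative if R_{ij} = 0. -/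
open scoped RealInnerProductSpace

open Polynomial in
/-- The coefficient vector of a polynomial of degree less than `m` paired with the moment curve
point at `x` gives the value of the polynomial at `x`. -/
lemma inner_coeff_moment_eq_eval {m : ℕ} {p : ℝ[X]} (hp : p.natDegree < m) (x : ℝ) :
    ⟪(WithLp.toLp 2 fun l : Fin m => p.coeff l : EuclideanSpace ℝ (Fin m)),
      WithLp.toLp 2 fun l : Fin m => x ^ (l : ℕ)⟫ = p.eval x := by
  rw [eval_eq_sum_range' hp, ← Fin.sum_univ_eq_sum_range (fun l => p.coeff l * x ^ l)]
  simp [PiLp.inner_apply, mul_comm]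

open Polynomial in
/-- For every finite set `s` of naturals there is a real polynomial of degree at most `2 * #s`
that is positive at the points of `s` and negative at all other naturals. -/
lemma exists_polynomial_sign_pattern (s : Finset ℕ) :
    ∃ p : ℝ[X], p.natDegree ≤ 2 * s.card ∧
      ∀ j : ℕ, (j ∈ s → 0 < p.eval (j : ℝ)) ∧ (j ∉ s → p.eval (j : ℝ) < 0) := by
  refine ⟨C (1 / 2) - ∏ a ∈ s, (X - C (a : ℝ)) ^ 2, ?_, fun j => ⟨fun hj => ?_, fun hj => ?_⟩⟩
  · refine (natDegree_sub_le _ _).trans (max_le (by simp) ((natDegree_prod_le _ _).trans ?_))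
    simp only [natDegree_pow, natDegree_X_sub_C, Finset.sum_const, smul_eq_mul]
    omega
  · have h : ∏ a ∈ s, ((j : ℝ) - a) ^ 2 = 0 := Finset.prod_eq_zero hj (by simp)
    simp [eval_prod, h]
  · have h : 1 ≤ ∏ a ∈ s, ((j : ℝ) - a) ^ 2 := by
      refine Finset.one_le_prod fun a ha => ?_
      have hja : (j : ℤ) - a ≠ 0 := by
        rw [sub_ne_zero]
        exact_mod_cast fun h : j = a => hj (h ▸ ha)
      have : (1 : ℤ) ≤ ((j : ℤ) - a) ^ 2 := by
        have := pow_pos (abs_pos.mpr hja) 2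
        rw [sq_abs] at this
        omega
      exact_mod_cast this
    simp only [eval_sub, eval_C, eval_prod, eval_pow, eval_X]
    linarith

/-- For a binary relevance matrix `R ∈ {0,1}^{q×n}` with at most `k` ones
per row, there are query and document embeddings in `ℝ^{2k+1}` whose inner products are
positive exactly on the relevant pairs and negative on the irrelevant pairs. -/
theorem exists_embeddings_of_row_sparse (q n k : ℕ) (hq : 1 ≤ q) (hn : 1 ≤ n)
    (R : Matrix (Fin q) (Fin n) ℕ)
    (hR : ∀ i j, R i j = 0 ∨ R i j = 1)
    (hrow : ∀ i, (Finset.univ.filter (fun j => R i j = 1)).card ≤ k) :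
    ∃ (u : Fin q → EuclideanSpace ℝ (Fin (2 * k + 1)))
      (v : Fin n → EuclideanSpace ℝ (Fin (2 * k + 1))),
      ∀ i j, (R i j = 1 → 0 < ⟪u i, v j⟫) ∧ (R i j = 0 → ⟪u i, v j⟫ < 0) := by
  choose p hdeg hsign using fun i => exists_polynomial_sign_pattern
    ((Finset.univ.filter (fun j => R i j = 1)).map Fin.valEmbedding)
  have hlt (i) : (p i).natDegree < 2 * k + 1 := by
    have h := hdeg i
    rw [Finset.card_map] at h
    have := hrow i
    omega
  refine ⟨fun i => WithLp.toLp 2 fun l => (p i).coeff l,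
    fun j => WithLp.toLp 2 fun l => (j : ℝ) ^ (l : ℕ), fun i j => ?_⟩
  rw [inner_coeff_moment_eq_eval (hlt i)]
  refine ⟨fun h => (hsign i j).1 ?_, fun h => (hsign i j).2 ?_⟩
  · simpa [Fin.val_inj] using h
  · simp [Fin.val_inj, h]
end

section
/- Let ε ≥ 0, let U be a finite index set, and let (ê_u)_{u∈U} be unit vectors in ℝ^{d} with |⟨ê_a, ê_b⟩| ≤ ε for all a ≠ b. For X ⊆ U set Ẽ(X) = Σ_{u∈X} ê_u. Let Q, D, D' ⊆ U be subsets such that 2ε·|Q|·|D| < 1 and 2ε·|Q|·|D'| < 1. If |Q ∩ D| > |Q ∩ D'|, then ⟨Ẽ(Q), Ẽ(D)⟩ > ⟨Ẽ(Q), Ẽ(D')⟩. In particular, for a fixed query set Q, the ordering of documents by the embedding score ⟨Ẽ(Q), Ẽ(D)⟩ agrees with the ordering by the set-theoretic relevance |Q ∩ D| / |Q|. -/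
open scoped RealInnerProductSpace

/-- The inner product of two sum embeddings of `ε`-almost-orthogonal unit vectors differs from the
size of the intersection by at most `ε` times the product of the sizes. -/
theorem abs_inner_sum_sub_card_inter_le {U E : Type*} [DecidableEq U] [NormedAddCommGroup E]
    [InnerProductSpace ℝ E] {ε : ℝ} (hε : 0 ≤ ε) {e : U → E} (hunit : ∀ u, ‖e u‖ = 1)
    (horth : ∀ a b : U, a ≠ b → |⟪e a, e b⟫| ≤ ε) (Q X : Finset U) :
    |⟪∑ u ∈ Q, e u, ∑ u ∈ X, e u⟫ - ((Q ∩ X).card : ℝ)| ≤ ε * Q.card * X.card := by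
  have hcard : ((Q ∩ X).card : ℝ) = ∑ a ∈ Q, ∑ b ∈ X, if a = b then (1 : ℝ) else 0 := by
    simp [Finset.sum_ite_mem]
  have hterm (a b : U) : |⟪e a, e b⟫ - if a = b then (1 : ℝ) else 0| ≤ ε := by
    split_ifs with h
    · simpa [h, hunit] using hε
    · simpa using horth a b h
  simp_rw [hcard, sum_inner, inner_sum, ← Finset.sum_sub_distrib]
  calc
    _ ≤ ∑ a ∈ Q, ∑ b ∈ X, |⟪e a, e b⟫ - if a = b then (1 : ℝ) else 0| :=
      (Finset.abs_sum_le_sum_abs _ _).trans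
        (Finset.sum_le_sum fun _ _ => Finset.abs_sum_le_sum_abs _ _)
    _ ≤ ∑ _a ∈ Q, ∑ _b ∈ X, ε :=
      Finset.sum_le_sum fun a _ => Finset.sum_le_sum fun b _ => hterm a b
    _ = ε * Q.card * X.card := by
      simp only [Finset.sum_const, nsmul_eq_mul]
      ring

/-- With ε-almost-orthogonal unit vectors and sum embeddings, if
`2ε|Q||D| < 1` and `2ε|Q||D'| < 1`, then a larger intersection with the query yields a
strictly larger embedding score: `|Q ∩ D'| < |Q ∩ D|` implies
`⟨Ẽ(Q), Ẽ(D')⟩ < ⟨Ẽ(Q), Ẽ(D)⟩`. -/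
theorem sum_embedding_order_preserving {U : Type*} [Fintype U] [DecidableEq U] {d : ℕ}
    (ε : ℝ) (hε : 0 ≤ ε)
    (e : U → EuclideanSpace ℝ (Fin d)) (hunit : ∀ u, ‖e u‖ = 1)
    (horth : ∀ a b : U, a ≠ b → |⟪e a, e b⟫| ≤ ε)
    (Q D D' : Finset U)
    (hQD : 2 * ε * (Q.card : ℝ) * (D.card : ℝ) < 1)
    (hQD' : 2 * ε * (Q.card : ℝ) * (D'.card : ℝ) < 1)
    (hcap : (Q ∩ D').card < (Q ∩ D).card) :
    ⟪∑ u ∈ Q, e u, ∑ u ∈ D', e u⟫ < ⟪∑ u ∈ Q, e u, ∑ u ∈ D, e u⟫ := by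
  have h := abs_le.mp (abs_inner_sum_sub_card_inter_le hε hunit horth Q D)
  have h' := abs_le.mp (abs_inner_sum_sub_card_inter_le hε hunit horth Q D')
  have hgap : ((Q ∩ D').card : ℝ) + 1 ≤ (Q ∩ D).card := by exact_mod_cast hcap
  linarith [h.1, h'.2]
end
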